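/- Fix n ≥ 1 and ε > 0, and define valuations v₁,…,vₙ : (ℝ≥0)ⁿ → ℝ by v₁(s) = (Σ_{i=1}^{n} s_i) + ε, v₂(s) = √n · s₂, and v_i(s) = s_i for every 3 ≤ i ≤ n. Then this valuation profile satisfies single-crossing: for every pair of bidders i, i' ∈ {1,…,n}, every s ∈ (ℝ≥0)ⁿ, and every δ ≥ 0, v_i(s + δ·e_i) − v_i(s) ≥ v_{i'}(s + δ·e_i) − v_{i'}(s), where e_i is the i-th standard basis vector. -/

import Mathlib

/-- The valuation profile of the `Ω(√n)` lower-bound construction: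
`v₁(s) = (∑ i, s i) + ε`, `v₂(s) = √n · s₂`, and `vᵢ(s) = sᵢ` for `i ≥ 3`.
Bidder `i ∈ {1,…,n}` is represented by the index `i - 1 : Fin n`. -/
noncomputable def val (n : ℕ) (ε : ℝ) (i : Fin n) (s : Fin n → ℝ) : ℝ :=
  if i.val = 0 then (∑ j, s j) + ε
  else if i.val = 1 then Real.sqrt n * s i
  else s i

/-- The change of bidder `j`'s valuation when the signal of bidder `i` grows by `δ`. -/
theorem val_update_sub_val (n : ℕ) (ε : ℝ) (i j : Fin n) (s : Fin n → ℝ) (δ : ℝ) :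
    val n ε j (Function.update s i (s i + δ)) - val n ε j s =
      if j.val = 0 then δ
      else if j = i then (if j.val = 1 then Real.sqrt n * δ else δ)
      else 0 := by
  have hsum : ∑ k, Function.update s i (s i + δ) k = ∑ k, s k + δ := by
    rw [Finset.sum_update_of_mem (Finset.mem_univ i),
      ← Finset.add_sum_erase _ s (Finset.mem_univ i), Finset.sdiff_singleton_eq_erase]
    ring
  unfold val
  rw [hsum]
  by_cases hji : j = i
  · subst hji
    simp only [Function.update_self, if_true]
    split_ifs <;> ring
  · simp only [Function.update_of_ne hji, if_neg hji]
    split_ifs <;> ring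

theorem stmt_5 (n : ℕ) (hn : 1 ≤ n) (ε : ℝ) (hε : 0 < ε)
    (i i' : Fin n) (s : Fin n → ℝ) (hs : ∀ j, 0 ≤ s j) (δ : ℝ) (hδ : 0 ≤ δ) :
    val n ε i (Function.update s i (s i + δ)) - val n ε i s ≥
      val n ε i' (Function.update s i (s i + δ)) - val n ε i' s := by
  have hsqrt : δ ≤ Real.sqrt n * δ :=
    le_mul_of_one_le_left hδ (Real.one_le_sqrt.mpr (by exact_mod_cast hn))
  rw [val_update_sub_val, val_update_sub_val]
  by_cases h : i' = i
  · rw [h]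
  · simp only [if_true, if_neg h]
    split_ifs <;> linarith
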